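/- For every linear objective c : Fin n → ℝ there exists δ* ∈ P such that ∑ i, c i * δ* i ≤ ∑ i, c i * δ i for every δ ∈ P, and δ* has at most one split index, i.e. the set {i | 0 < δ* i ∧ δ* i < d i} has at most one element. (In words: the linear pricing objective over P attains its minimum at an extreme collection pattern.) -/

import Mathlib

/-- An extreme point of a convex body cannot be moved in two opposite directions. -/
theorem eq_zero_of_add_mem_of_sub_mem_of_mem_extremePoints {E : Type*} [AddCommGroup E]
    [Module ℝ E] {A : Set E} {x v : E} (hx : x ∈ A.extremePoints ℝ)
    (hadd : x + v ∈ A) (hsub : x - v ∈ A) : v = 0 := by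
  have hseg : x ∈ openSegment ℝ (x + v) (x - v) :=
    ⟨1 / 2, 1 / 2, by norm_num, by norm_num, by norm_num, by module⟩
  have h := (mem_extremePoints.1 hx).2 _ hadd _ hsub hseg
  simpa using h.1

/-- Transferring mass between two coordinates keeps a point inside a capped box. -/
theorem add_single_sub_single_mem {ι : Type*} [Fintype ι] [DecidableEq ι] {Q : ℝ}
    {d x : ι → ℝ} {i j : ι} {ε : ℝ} (hij : i ≠ j)
    (hx : x ∈ {δ : ι → ℝ | (∑ k, δ k) ≤ Q ∧ ∀ k, 0 ≤ δ k ∧ δ k ≤ d k})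
    (hi : 0 ≤ x i + ε ∧ x i + ε ≤ d i) (hj : 0 ≤ x j - ε ∧ x j - ε ≤ d j) :
    x + (Pi.single i ε - Pi.single j ε) ∈
      {δ : ι → ℝ | (∑ k, δ k) ≤ Q ∧ ∀ k, 0 ≤ δ k ∧ δ k ≤ d k} := by
  refine ⟨?_, fun k => ?_⟩
  · simpa [Finset.sum_add_distrib, Finset.sum_sub_distrib] using hx.1
  · rcases eq_or_ne k i with rfl | hki
    · simpa [hij] using hi
    · rcases eq_or_ne k j with rfl | hkj
      · simpa [hki, sub_eq_add_neg] using hj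
      · simpa [hki, hkj] using hx.2 k

/-- An extreme point of a capped box has at most one split index. -/
theorem subsingleton_split_of_mem_extremePoints {ι : Type*} [Fintype ι] {Q : ℝ} {d x : ι → ℝ}
    (hx : x ∈ {δ : ι → ℝ | (∑ k, δ k) ≤ Q ∧ ∀ k, 0 ≤ δ k ∧ δ k ≤ d k}.extremePoints ℝ) :
    {i | 0 < x i ∧ x i < d i}.Subsingleton := by
  classical
  rintro i ⟨hi₀, hi₁⟩ j ⟨hj₀, hj₁⟩
  by_contra hij
  obtain ⟨ε, hε, hlt⟩ : ∃ ε, 0 < ε ∧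
      ε < min (min (x i) (d i - x i)) (min (x j) (d j - x j)) :=
    exists_between (by simp [*])
  simp only [lt_min_iff] at hlt
  obtain ⟨⟨h₁, h₂⟩, h₃, h₄⟩ := hlt
  have hadd := add_single_sub_single_mem (ε := ε) hij hx.1
    ⟨by linarith, by linarith⟩ ⟨by linarith, by linarith⟩
  have hsub := add_single_sub_single_mem (ε := ε) (Ne.symm hij) hx.1
    ⟨by linarith, by linarith⟩ ⟨by linarith, by linarith⟩
  rw [← neg_sub, ← sub_eq_add_neg] at hsub
  have h := congrFun (eq_zero_of_add_mem_of_sub_mem_of_mem_extremePoints hx hadd hsub) i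
  simp [hij, hε.ne'] at h

/-- A continuous linear functional attains its minimum over a nonempty compact set at an
extreme point. -/
theorem exists_mem_extremePoints_forall_le {E : Type*} [AddCommGroup E] [Module ℝ E]
    [TopologicalSpace E] [T2Space E] [IsTopologicalAddGroup E] [ContinuousSMul ℝ E]
    [LocallyConvexSpace ℝ E] {A : Set E} (hA : IsCompact A) (hne : A.Nonempty)
    (l : E →L[ℝ] ℝ) : ∃ x ∈ A.extremePoints ℝ, ∀ y ∈ A, l x ≤ l y := by
  have hexp : IsExposed ℝ A ((-l).toExposed A) := ContinuousLinearMap.toExposed.isExposed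
  obtain ⟨z, hz, hmin⟩ := hA.exists_isMinOn hne l.continuous.continuousOn
  have hface : ((-l).toExposed A).Nonempty :=
    ⟨z, hz, fun y hy => by simpa using hmin hy⟩
  obtain ⟨x, hx⟩ := (hexp.isCompact hA).extremePoints_nonempty hface
  exact ⟨x, hexp.isExtreme.extremePoints_subset_extremePoints hx,
    fun y hy => by simpa using hx.1.2 y hy⟩


/-- For every linear objective `c`, the minimum of `∑ i, c i * δ i` over the collection
polytope `P` is attained at a point `δ*` of `P` with at most one split index
(an extreme collection pattern). -/
theorem stmt_3 (n : ℕ) (Q : ℝ) (hQ : 0 < Q) (d : Fin n → ℝ) (hd : ∀ i, 0 < d i)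
    (P : Set (Fin n → ℝ))
    (hP : P = {δ : Fin n → ℝ | (∑ i, δ i) ≤ Q ∧ ∀ i, 0 ≤ δ i ∧ δ i ≤ d i})
    (c : Fin n → ℝ) :
    ∃ δstar ∈ P, (∀ δ ∈ P, ∑ i, c i * δstar i ≤ ∑ i, c i * δ i) ∧
      {i : Fin n | 0 < δstar i ∧ δstar i < d i}.Subsingleton := by
  subst hP
  have hcompact : IsCompact
      {δ : Fin n → ℝ | (∑ i, δ i) ≤ Q ∧ ∀ i, 0 ≤ δ i ∧ δ i ≤ d i} := by
    refine (isCompact_Icc (a := (0 : Fin n → ℝ)) (b := d)).of_isClosed_subset ?_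
      fun δ hδ => ⟨fun i => (hδ.2 i).1, fun i => (hδ.2 i).2⟩
    simp only [Set.ofPred_and, Set.ofPred_forall]
    refine (isClosed_le (by fun_prop) (by fun_prop)).inter (isClosed_iInter fun i => ?_)
    exact (isClosed_le (by fun_prop) (by fun_prop)).inter
      (isClosed_le (by fun_prop) (by fun_prop))
  obtain ⟨x, hx, hmin⟩ := exists_mem_extremePoints_forall_le hcompact
    ⟨0, by simpa using hQ.le, fun i => ⟨le_rfl, (hd i).le⟩⟩
    (∑ i, c i • ContinuousLinearMap.proj (R := ℝ) (φ := fun _ : Fin n => ℝ) i)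
  exact ⟨x, hx.1, fun δ hδ => by simpa using hmin δ hδ,
    subsingleton_split_of_mem_extremePoints hx⟩
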